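/- Let K be a field, d ≥ 1, and let p, q ∈ K[X₁,…,X_d] with q ≠ 0. Let q = c·q₁^{e₁}⋯q_m^{e_m} be the factorization of q into a unit c and pairwise non-associate irreducible polynomials q₁,…,q_m with positive exponents e₁,…,e_m. Then the rational function f = p/q ∈ K(X₁,…,X_d) can be written as f = Σ_A p_A / ∏_{i∈A} q_i^{b_{A,i}}, where the sum ranges over subsets A ⊆ {1,…,m} such that the family (q_i)_{i∈A} is algebraically independent over K, each p_A ∈ K[X₁,…,X_d] (possibly zero), and the b_{A,i} are positive integers (possibly greater than e_i). -/

import Mathlib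

open MvPolynomial in
/-- If powers of a finite family are algebraically independent, so is the family. -/
lemma ad_indep_of_pow {K R ι : Type*} [Field K] [CommRing R] [IsDomain R] [Algebra K R]
    [Finite ι] (x : ι → R) (N : ℕ)
    (h : AlgebraicIndependent K (fun i => x i ^ N)) : AlgebraicIndependent K x := by
  let S := Algebra.adjoin K (Set.range x)
  let y : ι → S := fun i => ⟨x i, Algebra.subset_adjoin ⟨i, rfl⟩⟩
  have hyN : AlgebraicIndependent K (fun i => y i ^ N) := by
    apply AlgebraicIndependent.of_comp S.val
    exact h
  have htop : Algebra.adjoin K (Set.range y) = ⊤ := by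
    rw [← Algebra.adjoin_adjoin_coe_preimage (R := K) (s := Set.range x)]
    congr 1
    ext z
    constructor
    · rintro ⟨i, rfl⟩
      exact ⟨i, rfl⟩
    · rintro ⟨i, hi⟩
      exact ⟨i, Subtype.ext hi⟩
  have halg : Algebra.IsAlgebraic (Algebra.adjoin K (Set.range y)) S := by
    rw [htop]
    refine ⟨fun s => ?_⟩
    exact isAlgebraic_algebraMap (A := S) (⟨s, trivial⟩ : (⊤ : Subalgebra K S))
  have hb := Algebra.IsAlgebraic.isTranscendenceBasis_of_lift_le_trdeg_of_finite (R := K) y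
    hyN.lift_cardinalMk_le_trdeg
  exact hb.1.map' (f := S.val) Subtype.val_injective

/-- The elimination step for a dependent family. -/
lemma ad_step {K R F ι : Type*} [Field K] [CommRing R] [IsDomain R] [Algebra K R]
    [Field F] [Algebra R F] [IsFractionRing R F] [Fintype ι] (x : ι → R)
    (hx : ∀ i, x i ≠ 0) (hdep : ¬ AlgebraicIndependent K x) (G : AddSubgroup F)
    (hG : ∀ (i₀ : ι) (p : R) (f : ι → ℕ), f i₀ = 0 →
      algebraMap R F p / algebraMap R F (∏ i, x i ^ f i) ∈ G)
    (p : R) (f : ι → ℕ) :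
    algebraMap R F p / algebraMap R F (∏ i, x i ^ f i) ∈ G := by
  classical
  set N := ∑ i, f i with hN
  have hfN : ∀ i, f i ≤ N + 1 := fun i =>
    (Finset.single_le_sum (fun _ _ => Nat.zero_le _) (Finset.mem_univ i)).trans (Nat.le_succ _)
  have hinj := IsFractionRing.injective R F
  have hne : ∀ g : ι → ℕ, algebraMap R F (∏ i, x i ^ g i) ≠ 0 := fun g h =>
    (Finset.prod_ne_zero_iff.mpr fun i _ => pow_ne_zero (g i) (hx i))
      ((map_eq_zero_iff _ hinj).mp h)
  have hdN : ¬ AlgebraicIndependent K (fun i => x i ^ (N + 1)) := fun h =>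
    hdep (ad_indep_of_pow x (N + 1) h)
  rw [algebraicIndependent_iff] at hdN
  push Not at hdN
  obtain ⟨κ, hκ, hκ0⟩ := hdN
  obtain ⟨ν, hν, hmin⟩ := Finset.exists_min_image κ.support (fun μ => ∑ i, μ i)
    (MvPolynomial.support_nonempty.mpr hκ0)
  have hc : κ.coeff ν ≠ 0 := MvPolynomial.mem_support_iff.mp hν
  rw [MvPolynomial.aeval_def, MvPolynomial.eval₂_eq', ← Finset.add_sum_erase _ _ hν] at hκ
  simp only [← pow_mul] at hκ
  -- normalise the coefficient of the minimal monomial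
  set c := κ.coeff ν with hcdef
  have hκ' : ∏ i, x i ^ ((N + 1) * ν i) = ∑ μ ∈ κ.support.erase ν,
      algebraMap K R (-(c⁻¹ * κ.coeff μ)) * ∏ i, x i ^ ((N + 1) * μ i) := by
    have h1 : algebraMap K R c⁻¹ * algebraMap K R c = 1 := by
      rw [← map_mul, inv_mul_cancel₀ hc, map_one]
    have h2 : ∑ μ ∈ κ.support.erase ν,
        algebraMap K R (-(c⁻¹ * κ.coeff μ)) * ∏ i, x i ^ ((N + 1) * μ i) =
        - (algebraMap K R c⁻¹ * ∑ μ ∈ κ.support.erase ν,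
        algebraMap K R (κ.coeff μ) * ∏ i, x i ^ ((N + 1) * μ i)) := by
      rw [Finset.mul_sum, ← Finset.sum_neg_distrib]
      refine Finset.sum_congr rfl fun μ _ => ?_
      rw [map_neg, map_mul]; ring
    rw [h2]
    linear_combination (-(∏ i, x i ^ ((N + 1) * ν i))) * h1 + algebraMap K R c⁻¹ * hκ
  -- rewrite the fraction
  have key : algebraMap R F p / algebraMap R F (∏ i, x i ^ f i) =
      ∑ μ ∈ κ.support.erase ν,
        algebraMap R F (p * (∏ i, x i ^ (N + 1 - f i)) * algebraMap K R (-(c⁻¹ * κ.coeff μ)) *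
          ∏ i, x i ^ ((N + 1) * (μ i - (ν i + 1)))) /
        algebraMap R F (∏ i, x i ^ ((N + 1) * ((ν i + 1) - μ i))) := by
    have hterm : ∀ μ : ι →₀ ℕ,
        algebraMap R F (p * (∏ i, x i ^ (N + 1 - f i)) * algebraMap K R (-(c⁻¹ * κ.coeff μ)) *
          ∏ i, x i ^ ((N + 1) * (μ i - (ν i + 1)))) /
        algebraMap R F (∏ i, x i ^ ((N + 1) * ((ν i + 1) - μ i))) =
        algebraMap R F (p * (∏ i, x i ^ (N + 1 - f i)) *
          (algebraMap K R (-(c⁻¹ * κ.coeff μ)) * ∏ i, x i ^ ((N + 1) * μ i))) /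
        algebraMap R F (∏ i, x i ^ ((N + 1) * (ν i + 1))) := by
      intro μ
      rw [div_eq_div_iff (hne _) (hne _), ← map_mul, ← map_mul]
      congr 1
      have : (∏ i, x i ^ ((N + 1) * (μ i - (ν i + 1)))) * ∏ i, x i ^ ((N + 1) * (ν i + 1)) =
          (∏ i, x i ^ ((N + 1) * μ i)) * ∏ i, x i ^ ((N + 1) * ((ν i + 1) - μ i)) := by
        rw [← Finset.prod_mul_distrib, ← Finset.prod_mul_distrib]
        refine Finset.prod_congr rfl fun i _ => ?_
        rw [← pow_add, ← pow_add, ← mul_add, ← mul_add]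
        congr 2
        omega
      linear_combination (p * (∏ i, x i ^ (N + 1 - f i)) *
        algebraMap K R (-(c⁻¹ * κ.coeff μ))) * this
    rw [Finset.sum_congr rfl fun μ _ => hterm μ, ← Finset.sum_div, ← map_sum, ← Finset.mul_sum,
      ← hκ', div_eq_div_iff (hne _) (hne _), ← map_mul, ← map_mul]
    congr 1
    rw [mul_assoc, mul_assoc, ← Finset.prod_mul_distrib, ← Finset.prod_mul_distrib]
    congr 1
    refine Finset.prod_congr rfl fun i _ => ?_
    rw [← pow_add, ← pow_add]
    congr 1
    have := hfN i
    rw [mul_add, mul_one]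
    omega
  rw [key]
  refine G.sum_mem fun μ hμ => ?_
  obtain ⟨hμν, hμs⟩ := Finset.mem_erase.mp hμ
  have hex : ∃ i, ν i < μ i := by
    by_contra hcon
    push Not at hcon
    apply hμν
    have := (Finset.sum_eq_sum_iff_of_le fun i (_ : i ∈ Finset.univ) => hcon i).mp
      (le_antisymm (Finset.sum_le_sum fun i _ => hcon i) (hmin μ hμs))
    ext i
    exact this i (Finset.mem_univ i)
  obtain ⟨i₀, hi₀⟩ := hex
  refine hG i₀ _ (fun i => (N + 1) * ((ν i + 1) - μ i)) ?_
  have : ν i₀ + 1 - μ i₀ = 0 := by omega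
  simp [this]

/-- The set of elements with a decomposition of the required shape. -/
def adGood {R F : Type*} [CommRing R] [Field F] [Algebra R F] {m : ℕ} (x : Fin m → R)
    (hx : ∀ A : Finset (Fin m), algebraMap R F (∏ i ∈ A, x i) ≠ 0)
    (I : Finset (Fin m) → Prop) : AddSubgroup F where
  carrier := {z | ∃ (P : Finset (Fin m) → R) (N : ℕ), (∀ A, P A ≠ 0 → I A) ∧
    z = ∑ A, algebraMap R F (P A) / algebraMap R F (∏ i ∈ A, x i) ^ (N + 1)}
  zero_mem' := ⟨0, 0, by simp, by simp⟩
  neg_mem' := by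
    rintro _ ⟨P, N, hP, rfl⟩
    refine ⟨-P, N, fun A h => hP A (by simpa using h), ?_⟩
    simp [neg_div]
  add_mem' := by
    rintro _ _ ⟨P, N, hP, rfl⟩ ⟨P', N', hP', rfl⟩
    refine ⟨fun A => P A * (∏ i ∈ A, x i) ^ (N' + 1) + P' A * (∏ i ∈ A, x i) ^ (N + 1),
      N + N' + 1, fun A h => ?_, ?_⟩
    · by_contra hI
      have h1 : P A = 0 := by
        by_contra h'
        exact hI (hP A h')
      have h2 : P' A = 0 := by
        by_contra h'
        exact hI (hP' A h')
      simp [h1, h2] at h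
    · rw [← Finset.sum_add_distrib]
      refine Finset.sum_congr rfl fun A _ => ?_
      have h0 := hx A
      rw [div_add_div _ _ (pow_ne_zero _ h0) (pow_ne_zero _ h0), map_add, map_mul, map_mul,
        map_pow, map_pow]
      congr 1 <;> ring

lemma ad_main {K R F : Type*} [Field K] [CommRing R] [IsDomain R] [Algebra K R]
    [Field F] [Algebra R F] [IsFractionRing R F] {m : ℕ} (x : Fin m → R)
    (hx0 : ∀ i, x i ≠ 0)
    (hx : ∀ A : Finset (Fin m), algebraMap R F (∏ i ∈ A, x i) ≠ 0) (n : ℕ) :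
    ∀ (A : Finset (Fin m)), A.card = n → ∀ (p : R) (f : Fin m → ℕ),
      algebraMap R F p / algebraMap R F (∏ i ∈ A, x i ^ f i) ∈
        adGood (F := F) x hx (fun A => AlgebraicIndependent K (fun i : A => x i)) := by
  classical
  induction n with
  | zero =>
    intro A hA p f
    rw [Finset.card_eq_zero] at hA
    subst hA
    refine ⟨fun A => if A = ∅ then p else 0, 0, fun A h => ?_, ?_⟩
    · have : A = ∅ := by
        by_contra h'
        simp [h'] at h
      subst this
      exact algebraicIndependent_empty_type_iff.mpr (algebraMap K R).injective
    · rw [Finset.sum_eq_single ∅] <;> simp +contextual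
  | succ n ih =>
    intro A hA p f
    by_cases hI : AlgebraicIndependent K (fun i : A => x i)
    · set N := ∑ i, f i
      have hfN : ∀ i, f i ≤ N + 1 := fun i =>
        (Finset.single_le_sum (fun _ _ => Nat.zero_le _) (Finset.mem_univ i)).trans
          (Nat.le_succ _)
      refine ⟨fun B => if B = A then p * ∏ i ∈ A, x i ^ (N + 1 - f i) else 0, N,
        fun B h => ?_, ?_⟩
      · have : B = A := by
          by_contra h'
          simp [h'] at h
        subst this
        exact hI
      · rw [Finset.sum_eq_single A]
        · simp only [if_true]
          rw [div_eq_div_iff _ (pow_ne_zero _ (hx A)), ← map_pow, ← map_mul,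
            ← map_mul]
          · congr 1
            rw [mul_assoc, ← Finset.prod_mul_distrib, ← Finset.prod_pow]
            congr 1
            refine Finset.prod_congr rfl fun i _ => ?_
            rw [← pow_add]
            congr 1
            have := hfN i
            omega
          · rw [Ne, map_eq_zero_iff _ (IsFractionRing.injective R F)]
            exact Finset.prod_ne_zero_iff.mpr fun i _ => pow_ne_zero _ (hx0 i)
        · intro B _ hB
          simp [hB]
        · simp
    · have hs := ad_step (K := K) (F := F) (fun i : A => x i) (fun i => hx0 i) hI
        (adGood (F := F) x hx (fun A => AlgebraicIndependent K (fun i : A => x i))) ?_ p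
        (fun i => f i)
      · rwa [Finset.prod_coe_sort A (fun i => x i ^ f i)] at hs
      · intro i₀ p' f' h0
        have := ih (A.erase i₀) (by rw [Finset.card_erase_of_mem i₀.2, hA]; rfl) p'
          (fun j => if h : j ∈ A then f' ⟨j, h⟩ else 0)
        rw [Finset.prod_erase _ (by simp [h0]), ← Finset.prod_coe_sort] at this
        simpa using this

/-- **Algebraic dependence decomposition** (Lemma 6, Leĭnartas's Lemma 2).
Let `q = c · q₁^{e₁} ⋯ q_m^{e_m}` be the factorization of `q ≠ 0` into a unit and
pairwise non-associate irreducibles.  Then `p/q` can be written as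
`Σ_A p_A / ∏_{i∈A} q_i^{b_{A,i}}`, the sum over subsets `A ⊆ {1,…,m}` such that
the family `(q_i)_{i∈A}` is algebraically independent over `K`. -/
theorem algebraic_dependence_decomposition {K : Type*} [Field K] {d m : ℕ} (hd : 1 ≤ d)
    (p q : MvPolynomial (Fin d) K) (hq : q ≠ 0)
    (c : MvPolynomial (Fin d) K) (hc : IsUnit c)
    (qi : Fin m → MvPolynomial (Fin d) K) (e : Fin m → ℕ)
    (hirr : ∀ i, Irreducible (qi i)) (he : ∀ i, 0 < e i)
    (hassoc : ∀ i j, i ≠ j → ¬ Associated (qi i) (qi j))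
    (hfac : q = c * ∏ i, qi i ^ e i) :
    ∃ (P : Finset (Fin m) → MvPolynomial (Fin d) K)
      (b : Finset (Fin m) → Fin m → ℕ),
      (∀ A, ∀ i ∈ A, 0 < b A i) ∧
      (∀ A, P A ≠ 0 → AlgebraicIndependent K (fun i : A => qi (i : Fin m))) ∧
      algebraMap (MvPolynomial (Fin d) K) (FractionRing (MvPolynomial (Fin d) K)) p /
          algebraMap (MvPolynomial (Fin d) K) (FractionRing (MvPolynomial (Fin d) K)) q =
        ∑ A : Finset (Fin m),
          algebraMap (MvPolynomial (Fin d) K) (FractionRing (MvPolynomial (Fin d) K)) (P A) /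
            algebraMap (MvPolynomial (Fin d) K) (FractionRing (MvPolynomial (Fin d) K))
              (∏ i ∈ A, qi i ^ b A i) := by
  have hx0 : ∀ i, qi i ≠ 0 := fun i => (hirr i).ne_zero
  have hx : ∀ A : Finset (Fin m), algebraMap (MvPolynomial (Fin d) K)
      (FractionRing (MvPolynomial (Fin d) K)) (∏ i ∈ A, qi i) ≠ 0 := by
    intro A
    rw [Ne, map_eq_zero_iff _ (IsFractionRing.injective _ _)]
    exact Finset.prod_ne_zero_iff.mpr fun i _ => hx0 i
  obtain ⟨u, rfl⟩ := hc
  obtain ⟨P, N, hP, hsum⟩ := ad_main (K := K) (F := FractionRing (MvPolynomial (Fin d) K)) qi hx0 hx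
    _ Finset.univ rfl (p * ↑u⁻¹) e
  refine ⟨P, fun _ _ => N + 1, fun _ _ _ => Nat.succ_pos N, hP, ?_⟩
  have hq' : (∏ i, qi i ^ e i) ≠ 0 := Finset.prod_ne_zero_iff.mpr fun i _ => pow_ne_zero _ (hx0 i)
  have hinj := IsFractionRing.injective (MvPolynomial (Fin d) K)
    (FractionRing (MvPolynomial (Fin d) K))
  simp only [Finset.prod_pow, map_pow]
  rw [← hsum, div_eq_div_iff (by rwa [Ne, map_eq_zero_iff _ hinj])
    (by rwa [Ne, map_eq_zero_iff _ hinj]), ← map_mul, ← map_mul, hfac]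
  congr 1
  linear_combination (-(p * ∏ i, qi i ^ e i)) * u.inv_mul
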